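/- arXiv:2207.04308 — 3 statements merged into one kernel-verified Lean document; each statement's English description precedes it below -/
import Mathlib

section
/- (Observation 1, made precise) Let T ≥ 3 and let X : {1,…,T} → ℝ^n be a time series for which there exist indices 1 ≤ j < k < T with X_j ≠ X_{j+1} and X_k = X_{k+1}. Then for every δ with 0 ≤ δ < ‖X_j − X_{j+1}‖², there exist a perturbation ε : {1,…,T} → ℝ^n and an alignment path P such that dist_P(X, X + ε) = 0 ≤ δ while ‖(X+ε) − X‖₂² = ‖ε‖₂² > δ. (A valid choice is the time-warped series X' with X'_i = X_i for i ≤ j, X'_i = X_{i−1} for j < i ≤ k+1, and X'_i = X_i for i > k+1.) -/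
open scoped BigOperators

/-- A (multivariate) time series with `n` channels and window size `T`,
indexed `0, …, T-1` (0-based version of `{1,…,T}`), valued in Euclidean space `ℝ^n`. -/
abbrev TimeSeries (n T : ℕ) := Fin T → EuclideanSpace ℝ (Fin n)

/-- One admissible step of an alignment path: move right, down, or diagonally,
i.e. the increment of the cell is `(1,0)`, `(0,1)` or `(1,1)`. -/
def AlignStep {T : ℕ} (c c' : Fin T × Fin T) : Prop :=
  ((c'.1 : ℕ) = (c.1 : ℕ) + 1 ∧ (c'.2 : ℕ) = (c.2 : ℕ)) ∨
  ((c'.1 : ℕ) = (c.1 : ℕ) ∧ (c'.2 : ℕ) = (c.2 : ℕ) + 1) ∨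
  ((c'.1 : ℕ) = (c.1 : ℕ) + 1 ∧ (c'.2 : ℕ) = (c.2 : ℕ) + 1)

/-- The last index `T-1 : Fin T` (0-based version of `T` in `{1,…,T}`). -/
def lastIdx (T : ℕ) [NeZero T] : Fin T :=
  ⟨T - 1, Nat.sub_lt (Nat.pos_of_ne_zero (NeZero.ne T)) Nat.one_pos⟩

/-- An alignment path for length `T`: a finite sequence of cells of `{0,…,T-1}²`
starting at `(0,0)`, ending at `(T-1,T-1)`, with steps in `{(1,0),(0,1),(1,1)}`. -/
structure AlignmentPath (T : ℕ) [NeZero T] where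
  cells : List (Fin T × Fin T)
  ne : cells ≠ []
  head_eq : cells.head ne = (0, 0)
  last_eq : cells.getLast ne = (lastIdx T, lastIdx T)
  chain : cells.Chain' AlignStep

/-- `dist_P(X,Z) = Σ_{(i,j) ∈ P} ‖X_i − Z_j‖²` (ground cost: squared Euclidean distance). -/
noncomputable def pathDist {n T : ℕ} [NeZero T] (P : AlignmentPath T)
    (X Z : TimeSeries n T) : ℝ :=
  (P.cells.map (fun c => ‖X c.1 - Z c.2‖ ^ 2)).sum

/-- `DTW(X,Z)`: the minimum of `dist_P(X,Z)` over all alignment paths `P`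
(the minimum exists: the set of alignment paths is finite and nonempty). -/
noncomputable def DTW {n T : ℕ} [NeZero T] (X Z : TimeSeries n T) : ℝ :=
  sInf {r : ℝ | ∃ P : AlignmentPath T, pathDist P X Z = r}

/-- `‖X − Z‖₂² = Σ_{i=1}^{T} ‖X_i − Z_i‖²`, the squared Euclidean distance of time series. -/
noncomputable def l2sq {n T : ℕ} (X Z : TimeSeries n T) : ℝ :=
  ∑ i, ‖X i - Z i‖ ^ 2

/-- `‖c − c'‖₁ = |i − i'| + |j − j'|` for cells `c = (i,j)`, `c' = (i',j')`. -/
def cellDist {T : ℕ} (c c' : Fin T × Fin T) : ℕ :=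
  ((c.1 : ℤ) - (c'.1 : ℤ)).natAbs + ((c.2 : ℤ) - (c'.2 : ℤ)).natAbs

/-- `min_{c' ∈ P} ‖c − c'‖₁`: distance from a cell to the closest cell of a path. -/
noncomputable def minDistToPath {T : ℕ} [NeZero T] (c : Fin T × Fin T)
    (P : AlignmentPath T) : ℕ :=
  sInf {d : ℕ | ∃ c' ∈ P.cells, d = cellDist c c'}

/-- `PathSim(P₁,P₂) = (1/(2T)) (Σ_{c ∈ P₁} min_{c' ∈ P₂} ‖c − c'‖₁
    + Σ_{c ∈ P₂} min_{c' ∈ P₁} ‖c − c'‖₁)`. -/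
noncomputable def PathSim {T : ℕ} [NeZero T] (P₁ P₂ : AlignmentPath T) : ℝ :=
  (1 / (2 * (T : ℝ))) *
    ((P₁.cells.map (fun c => (minDistToPath c P₂ : ℝ))).sum +
     (P₂.cells.map (fun c => (minDistToPath c P₁ : ℝ))).sum)

/-- **Observation 1, made precise.** Let `T ≥ 3` and let `X` be a time
series with indices `j < k` (with `k+1 < T`, 0-based) such that `X_j ≠ X_{j+1}` and
`X_k = X_{k+1}`. Then for every `δ` with `0 ≤ δ < ‖X_j − X_{j+1}‖²` there are a
perturbation `ε` and an alignment path `P` with `dist_P(X, X+ε) = 0 ≤ δ` while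
`‖(X+ε) − X‖₂² > δ`. -/
theorem exists_perturbation_zero_pathDist_large_l2 {n T : ℕ} [NeZero T]
    (hn : 1 ≤ n) (hT : 3 ≤ T)
    (X : TimeSeries n T) (j k : ℕ) (hjk : j < k) (hk : k + 1 < T)
    (hXj : X ⟨j, by omega⟩ ≠ X ⟨j + 1, by omega⟩)
    (hXk : X ⟨k, by omega⟩ = X ⟨k + 1, by omega⟩)
    (δ : ℝ) (hδ0 : 0 ≤ δ) (hδ : δ < ‖X ⟨j, by omega⟩ - X ⟨j + 1, by omega⟩‖ ^ 2) :
    ∃ (ε : TimeSeries n T) (P : AlignmentPath T),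
      pathDist P X (X + ε) = 0 ∧ pathDist P X (X + ε) ≤ δ ∧
      l2sq (X + ε) X > δ := by
  have hT0 : 0 < T := by omega
  let a : ℕ → ℕ := fun i => if i ≤ j then i else if i ≤ k + 1 then i - 1 else i
  have ha : ∀ i : Fin T, a i < T := by
    intro i
    have := i.2
    simp only [a]
    split_ifs <;> omega
  let X' : TimeSeries n T := fun i => X ⟨a i, ha i⟩
  let f : Fin (T + 1) → Fin T × Fin T := fun m =>
    (⟨if (m : ℕ) ≤ j then m else m - 1, by have := m.2; split_ifs <;> omega⟩,
     ⟨if (m : ℕ) ≤ k + 1 then m else m - 1, by have := m.2; split_ifs <;> omega⟩)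
  have hlen : (List.ofFn f).length = T + 1 := List.length_ofFn
  have hne : List.ofFn f ≠ [] := by
    intro h
    rw [h] at hlen
    simp at hlen
  let P : AlignmentPath T :=
    { cells := List.ofFn f
      ne := hne
      head_eq := by
        rw [List.head_eq_getElem, List.getElem_ofFn]
        simp only [f]
        ext <;> simp
      last_eq := by
        rw [List.getLast_eq_getElem, List.getElem_ofFn]
        simp only [f, lastIdx, hlen]
        ext <;> simp <;> omega
      chain := by
        refine List.isChain_iff_getElem.2 ?_
        intro i hi
        rw [List.getElem_ofFn, List.getElem_ofFn]
        simp only [AlignStep, f]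
        split_ifs <;> omega }
  have key : X + (X' - X) = X' := by abel
  have hP : pathDist P X X' = 0 := by
    unfold pathDist
    apply List.sum_eq_zero
    intro x hx
    obtain ⟨c, hc, rfl⟩ := List.mem_map.1 hx
    obtain ⟨m, rfl⟩ := (List.mem_ofFn' f c).1 hc
    have h : X (f m).1 = X' (f m).2 := by
      have hm := m.2
      simp only [X']
      by_cases h1 : (m : ℕ) = k + 2
      · have e1 : (f m).1 = ⟨k + 1, by omega⟩ := by
          ext; simp only [f]; split_ifs <;> omega
        have e2 : (⟨a (f m).2, ha _⟩ : Fin T) = ⟨k, by omega⟩ := by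
          ext; simp only [f, a]; split_ifs <;> omega
        rw [e1, e2, hXk]
      · congr 1
        ext
        simp only [f, a]
        split_ifs <;> omega
    simp [h]
  refine ⟨X' - X, P, ?_, ?_, ?_⟩
  · rw [key, hP]
  · rw [key, hP]; exact hδ0
  · rw [key]
    refine lt_of_lt_of_le hδ ?_
    have e : X' ⟨j + 1, by omega⟩ = X ⟨j, by omega⟩ := by
      simp only [X']
      congr 1
      ext
      simp only [a]
      split_ifs <;> omega
    rw [← e]
    exact Finset.single_le_sum (f := fun i => ‖X' i - X i‖ ^ 2)
      (fun i _ => by positivity) (Finset.mem_univ (⟨j + 1, by omega⟩ : Fin T))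
end

section
/- (Theorem 1, strictness part) Let T ≥ 3 and let X : {1,…,T} → ℝ^n be a time series for which there exist indices 1 ≤ j < k < T with X_j ≠ X_{j+1} and X_k = X_{k+1}. Then for every δ with 0 ≤ δ < ‖X_j − X_{j+1}‖², the inclusion { Z : DTW(X,Z) ≤ δ } ⊇ { Z : ‖X − Z‖₂² ≤ δ } is strict: there exists X_adv with DTW(X, X_adv) ≤ δ and ‖X − X_adv‖₂² > δ, so the DTW-constrained set of candidate adversarial examples is a strict superset of the Euclidean-constrained one. -/
open scoped BigOperators

/-- Build an alignment path from a function on `Fin (m+1)`; membership controls costs. -/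
theorem exists_path {T : ℕ} [NeZero T] (m : ℕ) (f : Fin (m + 1) → Fin T × Fin T)
    (h0 : f 0 = (0, 0)) (hl : f (Fin.last m) = (lastIdx T, lastIdx T))
    (hs : ∀ (i : ℕ) (hi : i + 1 < m + 1), AlignStep (f ⟨i, by omega⟩) (f ⟨i + 1, hi⟩)) :
    ∃ P : AlignmentPath T, P.cells = List.ofFn f := by
  refine ⟨⟨List.ofFn f, by simp, ?_, ?_, ?_⟩, rfl⟩
  · rw [List.head_ofFn]; exact h0
  · rw [List.getLast_ofFn]; exact hl
  · exact List.isChain_ofFn.2 hs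

theorem DTW_le_pathDist {n T : ℕ} [NeZero T] (P : AlignmentPath T) (X Z : TimeSeries n T) :
    DTW X Z ≤ pathDist P X Z := by
  apply csInf_le
  · refine ⟨0, ?_⟩
    rintro r ⟨Q, rfl⟩
    unfold pathDist
    apply List.sum_nonneg
    intro x hx
    obtain ⟨c, -, rfl⟩ := List.mem_map.1 hx
    positivity
  · exact ⟨P, rfl⟩

theorem DTW_le_l2sq {n T : ℕ} [NeZero T] (X Z : TimeSeries n T) : DTW X Z ≤ l2sq X Z := by
  obtain ⟨m, rfl⟩ : ∃ m, T = m + 1 := ⟨T - 1, by have := NeZero.ne T; omega⟩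
  obtain ⟨P, hP⟩ := exists_path (T := m + 1) m (fun i => (i, i))
    (by ext <;> simp) (by ext <;> simp [lastIdx])
    (by intro i hi; right; right; simp)
  refine (DTW_le_pathDist P X Z).trans (le_of_eq ?_)
  unfold pathDist l2sq
  rw [hP, List.map_ofFn, List.sum_ofFn]
  rfl

theorem exists_adv {n T : ℕ} [NeZero T]
    (X : TimeSeries n T) (j k : ℕ) (hjk : j < k) (hk : k + 1 < T)
    (hXk : X ⟨k, by omega⟩ = X ⟨k + 1, by omega⟩) :
    ∃ Z : TimeSeries n T, DTW X Z ≤ 0 ∧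
      ‖X ⟨j, by omega⟩ - X ⟨j + 1, by omega⟩‖ ^ 2 ≤ l2sq X Z := by
  let Z : TimeSeries n T := fun i =>
    if j < i.1 ∧ i.1 ≤ k then X ⟨i.1 - 1, by omega⟩ else X i
  refine ⟨Z, ?_, ?_⟩
  · obtain ⟨P, hP⟩ := exists_path (T := T) T
      (fun i => (⟨if i.1 ≤ j then i.1 else i.1 - 1, by split_ifs <;> omega⟩,
        ⟨if i.1 ≤ k + 1 then i.1 else i.1 - 1, by split_ifs <;> omega⟩))
      (by ext <;> simp)
      (by ext <;> simp [lastIdx] <;> omega)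
      (by intro i hi; simp only [AlignStep]; split_ifs <;> omega)
    refine (DTW_le_pathDist P X Z).trans (le_of_eq ?_)
    unfold pathDist
    rw [hP, List.map_ofFn, List.sum_ofFn]
    apply Finset.sum_eq_zero
    intro i _
    have key : ∀ a b : Fin T, (a.1 = b.1 ∧ ¬ (j < b.1 ∧ b.1 ≤ k) ∨
        a.1 = b.1 - 1 ∧ (j < b.1 ∧ b.1 ≤ k) ∨ a.1 = k ∧ b.1 = k + 1) →
        ‖X a - Z b‖ ^ 2 = 0 := by
      intro a b h
      have : X a = Z b := by
        rcases h with ⟨h1, h2⟩ | ⟨h1, h2⟩ | ⟨h1, h2⟩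
        · simp only [Z, if_neg h2]; congr 1; exact Fin.ext h1
        · simp only [Z, if_pos h2]; congr 1; exact Fin.ext h1
        · have h3 : ¬ (j < b.1 ∧ b.1 ≤ k) := by omega
          simp only [Z, if_neg h3]
          have ha : a = ⟨k, by omega⟩ := Fin.ext h1
          have hb : b = ⟨k + 1, by omega⟩ := Fin.ext h2
          exact (congrArg X ha).trans (hXk.trans (congrArg X hb).symm)
      simp [this]
    apply key
    dsimp only
    split_ifs <;> omega
  · unfold l2sq
    have h := Finset.single_le_sum (f := fun i => ‖X i - Z i‖ ^ 2) (s := Finset.univ)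
      (fun i _ => by positivity) (Finset.mem_univ (⟨j + 1, by omega⟩ : Fin T))
    refine le_trans (le_of_eq ?_) h
    have h3 : j < j + 1 ∧ j + 1 ≤ k := by omega
    simp only [Z, if_pos h3]
    rw [norm_sub_rev]
    rfl

/-- **Theorem 1, strictness part.** Let `T ≥ 3` and let `X` be a time
series with indices `j < k` (with `k+1 < T`, 0-based) such that `X_j ≠ X_{j+1}` and
`X_k = X_{k+1}`. Then for every `δ` with `0 ≤ δ < ‖X_j − X_{j+1}‖²`, there exists
`X_adv` with `DTW(X, X_adv) ≤ δ` and `‖X − X_adv‖₂² > δ`, so the DTW-constrained set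
is a strict superset of the Euclidean-constrained one. -/
theorem DTW_ball_strict_superset {n T : ℕ} [NeZero T]
    (hn : 1 ≤ n) (hT : 3 ≤ T)
    (X : TimeSeries n T) (j k : ℕ) (hjk : j < k) (hk : k + 1 < T)
    (hXj : X ⟨j, by omega⟩ ≠ X ⟨j + 1, by omega⟩)
    (hXk : X ⟨k, by omega⟩ = X ⟨k + 1, by omega⟩)
    (δ : ℝ) (hδ0 : 0 ≤ δ) (hδ : δ < ‖X ⟨j, by omega⟩ - X ⟨j + 1, by omega⟩‖ ^ 2) :
    (∃ Xadv : TimeSeries n T, DTW X Xadv ≤ δ ∧ l2sq X Xadv > δ) ∧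
    {Z : TimeSeries n T | l2sq X Z ≤ δ} ⊂ {Z : TimeSeries n T | DTW X Z ≤ δ} := by
  obtain ⟨Z, h1, h2⟩ := exists_adv X j k hjk hk hXk
  have hZ1 : DTW X Z ≤ δ := h1.trans hδ0
  have hZ2 : δ < l2sq X Z := hδ.trans_le h2
  refine ⟨⟨Z, hZ1, hZ2⟩, ?_⟩
  refine Set.ssubset_iff_of_subset (fun W hW => (DTW_le_l2sq X W).trans hW) |>.2 ⟨Z, hZ1, ?_⟩
  exact not_le.2 hZ2
end

section
/- (PathSim is a valid similarity measure) For all alignment paths P₁, P₂ (for length T ≥ 1): (i) PathSim(P₁,P₂) ≥ 0; (ii) PathSim(P₁,P₂) = PathSim(P₂,P₁); (iii) PathSim(P₁,P₂) = 0 if and only if P₁ = P₂ (as sequences of cells). For part (iii), the forward direction uses that PathSim(P₁,P₂) = 0 forces the underlying sets of cells of P₁ and P₂ to coincide, and that an alignment path is uniquely determined by its set of cells, since its cells are visited in a strictly increasing order with steps in {(1,0),(0,1),(1,1)}. -/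
open scoped BigOperators

theorem cellDist_eq_zero {T : ℕ} (c c' : Fin T × Fin T) : cellDist c c' = 0 ↔ c = c' := by
  unfold cellDist
  rw [Prod.ext_iff, Fin.ext_iff, Fin.ext_iff]
  omega

theorem minDistToPath_eq_zero {T : ℕ} [NeZero T] (c : Fin T × Fin T) (P : AlignmentPath T) :
    minDistToPath c P = 0 ↔ c ∈ P.cells := by
  unfold minDistToPath
  rw [Nat.sInf_eq_zero]
  constructor
  · rintro (⟨c', hc', h⟩ | h)
    · rw [(cellDist_eq_zero c c').1 h.symm]
      exact hc'
    · exfalso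
      have hm : cellDist c (P.cells.head P.ne) ∈
          {d : ℕ | ∃ c' ∈ P.cells, d = cellDist c c'} := ⟨_, List.head_mem P.ne, rfl⟩
      rw [h] at hm
      exact hm
  · intro h
    exact Or.inl ⟨c, h, ((cellDist_eq_zero c c).2 rfl).symm⟩

theorem sum_map_nat_eq_zero {α : Type*} (l : List α) (f : α → ℕ) :
    (l.map (fun c => (f c : ℝ))).sum = 0 ↔ ∀ c ∈ l, f c = 0 := by
  have h : (l.map (fun c => (f c : ℝ))).sum = (((l.map f).sum : ℕ) : ℝ) := by
    induction l with
    | nil => simp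
    | cons a l ih => simp [ih]
  rw [h, Nat.cast_eq_zero, List.sum_eq_zero_iff]
  simp

theorem sum_map_nat_nonneg {α : Type*} (l : List α) (f : α → ℕ) :
    0 ≤ (l.map (fun c => (f c : ℝ))).sum := by
  apply List.sum_nonneg
  simp

theorem AlignmentPath.pairwise_lt {T : ℕ} [NeZero T] (P : AlignmentPath T) :
    P.cells.Pairwise (· < ·) := by
  rw [← List.isChain_iff_pairwise]
  refine List.IsChain.imp ?_ P.chain
  intro a b h
  rw [Prod.lt_iff]
  simp only [Fin.lt_def, Fin.le_def]
  unfold AlignStep at h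
  omega

theorem AlignmentPath.cells_eq {T : ℕ} [NeZero T] (P Q : AlignmentPath T)
    (h : ∀ c, c ∈ P.cells ↔ c ∈ Q.cells) : P.cells = Q.cells :=
  List.Pairwise.eq_of_mem_iff P.pairwise_lt Q.pairwise_lt (fun c => h c)

/-- **PathSim is a valid similarity measure.** For all alignment paths
`P₁, P₂`: (i) `PathSim(P₁,P₂) ≥ 0`; (ii) `PathSim(P₁,P₂) = PathSim(P₂,P₁)`;
(iii) `PathSim(P₁,P₂) = 0` iff `P₁ = P₂` as sequences of cells. -/
theorem PathSim_is_similarity_measure {T : ℕ} [NeZero T] (hT : 1 ≤ T)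
    (P₁ P₂ : AlignmentPath T) :
    0 ≤ PathSim P₁ P₂ ∧
    PathSim P₁ P₂ = PathSim P₂ P₁ ∧
    (PathSim P₁ P₂ = 0 ↔ P₁.cells = P₂.cells) := by
  have h1 := sum_map_nat_nonneg P₁.cells (fun c => minDistToPath c P₂)
  have h2 := sum_map_nat_nonneg P₂.cells (fun c => minDistToPath c P₁)
  have hT' : (0 : ℝ) < 1 / (2 * (T : ℝ)) := by
    have : (0 : ℝ) < T := by exact_mod_cast hT
    positivity
  refine ⟨mul_nonneg hT'.le (add_nonneg h1 h2), ?_, ?_⟩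
  · unfold PathSim
    rw [add_comm]
  · unfold PathSim
    rw [mul_eq_zero, or_iff_right hT'.ne', add_eq_zero_iff_of_nonneg h1 h2,
      sum_map_nat_eq_zero, sum_map_nat_eq_zero]
    simp only [minDistToPath_eq_zero]
    constructor
    · rintro ⟨ha, hb⟩
      exact P₁.cells_eq P₂ fun c => ⟨ha c, hb c⟩
    · intro h
      rw [h]
      exact ⟨fun _ h => h, fun _ h => h⟩
end
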